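/- Let A and B be p × p real matrices, and let F^{AA^t} and F^{BB^t} be the empirical spectral distributions of AA^t and BB^t. Then the fourth power of the Levy distance between F^{AA^t} and F^{BB^t} is bounded by (2/p) tr((A - B)(A - B)^t) · (1/p) tr(AA^t + BB^t). -/

import Mathlib

open Matrix

/-- Empirical spectral distribution function of a Hermitian real matrix. -/
noncomputable def esd {p : ℕ} (M : Matrix (Fin p) (Fin p) ℝ) (hM : M.IsHermitian)
    (x : ℝ) : ℝ :=
  ((Finset.univ.filter (fun i => hM.eigenvalues i ≤ x)).card : ℝ) / p

/-- Levy distance between two distribution functions on ℝ. -/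
noncomputable def levyDist (F G : ℝ → ℝ) : ℝ :=
  sInf {ε : ℝ | 0 < ε ∧ ∀ x : ℝ, F (x - ε) - ε ≤ G x ∧ G x ≤ F (x + ε) + ε}

/-- Entrywise average of the squares of two matrices. -/
noncomputable def avgSq {n : Type*} (P Q : Matrix n n ℝ) : Matrix n n ℝ :=
  Matrix.of fun i j => (P i j ^ 2 + Q i j ^ 2) / 2

lemma sum_sq_row_of_mem_orthogonalGroup {n : Type*} [Fintype n] [DecidableEq n]
    {P : Matrix n n ℝ} (hP : P * Pᵀ = 1) (i : n) : ∑ j, P i j ^ 2 = 1 := by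
  simpa [Matrix.mul_apply, ← sq] using congrFun (congrFun hP i) i

lemma avgSq_mem_doublyStochastic {n : Type*} [Fintype n] [DecidableEq n]
    {P Q : Matrix n n ℝ} (hP : P * Pᵀ = 1) (hQ : Q * Qᵀ = 1) :
    avgSq P Q ∈ doublyStochastic ℝ n := by
  have hP' : Pᵀ * Pᵀᵀ = 1 := by rw [transpose_transpose]; exact mul_eq_one_comm.mp hP
  have hQ' : Qᵀ * Qᵀᵀ = 1 := by rw [transpose_transpose]; exact mul_eq_one_comm.mp hQ
  rw [mem_doublyStochastic_iff_sum]
  refine ⟨fun i j => ?_, fun i => ?_, fun j => ?_⟩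
  · simp only [avgSq, of_apply]; positivity
  · simp only [avgSq, of_apply]
    rw [← Finset.sum_div, Finset.sum_add_distrib, sum_sq_row_of_mem_orthogonalGroup hP,
      sum_sq_row_of_mem_orthogonalGroup hQ]
    norm_num
  · have h1 := sum_sq_row_of_mem_orthogonalGroup hP' j
    have h2 := sum_sq_row_of_mem_orthogonalGroup hQ' j
    simp only [transpose_apply] at h1 h2
    simp only [avgSq, of_apply]
    rw [← Finset.sum_div, Finset.sum_add_distrib, h1, h2]
    norm_num

/-- Singular value decomposition of a square real matrix, with singular values given as the
square roots of the eigenvalues of `A * Aᵀ`. -/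
lemma exists_svd {n : Type*} [Fintype n] [DecidableEq n] (A : Matrix n n ℝ)
    (hA : (A * Aᵀ).IsHermitian) :
    (∀ i, 0 ≤ hA.eigenvalues i) ∧ ∃ U W : Matrix n n ℝ, U * Uᵀ = 1 ∧ W * Wᵀ = 1 ∧
      A = U * diagonal (fun i => √(hA.eigenvalues i)) * Wᵀ := by
  have hnonneg : ∀ i, 0 ≤ hA.eigenvalues i := fun i => by
    have : (A * Aᵀ).PosSemidef := by
      simpa using posSemidef_self_mul_conjTranspose A
    exact this.eigenvalues_nonneg i
  refine ⟨hnonneg, ?_⟩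
  let U : Matrix n n ℝ := (hA.eigenvectorUnitary : Matrix n n ℝ)
  have hU : U * Uᵀ = 1 := by
    have := (mem_unitaryGroup_iff).mp hA.eigenvectorUnitary.2
    simpa [star_eq_conjTranspose] using this
  have hU' : Uᵀ * U = 1 := mul_eq_one_comm.mp hU
  have hgram : (Aᵀ * U)ᵀ * (Aᵀ * U) = diagonal hA.eigenvalues := by
    have h := hA.spectral_theorem
    rw [Unitary.conjStarAlgAut_apply] at h
    have h' : A * Aᵀ = U * diagonal hA.eigenvalues * Uᵀ := by
      simpa [star_eq_conjTranspose, Function.comp_def] using h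
    calc (Aᵀ * U)ᵀ * (Aᵀ * U) = Uᵀ * (A * Aᵀ) * U := by
          simp [transpose_mul, Matrix.mul_assoc]
      _ = (Uᵀ * U) * diagonal hA.eigenvalues * (Uᵀ * U) := by
          refine (congrArg (fun X => Uᵀ * X * U) h').trans ?_
          simp only [Matrix.mul_assoc]
      _ = _ := by simp [hU']
  have hsq : ∀ i, √(hA.eigenvalues i) * √(hA.eigenvalues i) = hA.eigenvalues i :=
    fun i => Real.mul_self_sqrt (hnonneg i)
  let c : n → EuclideanSpace ℝ n := fun i => WithLp.toLp 2 ((Aᵀ * U).col i)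
  have hc : ∀ i j, inner ℝ (c i) (c j) = diagonal hA.eigenvalues i j := fun i j => by
    rw [← hgram, Matrix.mul_apply]
    simp only [transpose_apply]
    simp [c, PiLp.inner_apply, mul_comm]
  let v : n → EuclideanSpace ℝ n := fun i => (√(hA.eigenvalues i))⁻¹ • c i
  let s : Set n := {i | hA.eigenvalues i ≠ 0}
  have hv : Orthonormal ℝ (s.domRestrict v) := by
    rw [orthonormal_iff_ite]
    rintro ⟨i, hi⟩ ⟨j, hj⟩
    have hi' : √(hA.eigenvalues i) ≠ 0 := by
      rw [Real.sqrt_ne_zero (hnonneg i)]; exact hi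
    change inner ℝ (v i) (v j) = _
    simp only [v, inner_smul_left, inner_smul_right, hc, Subtype.mk.injEq]
    by_cases hij : i = j
    · subst hij
      rw [if_pos rfl, diagonal_apply_eq, ← hsq i]
      simp
      field_simp
    · simp [hij]
  obtain ⟨w, hw⟩ := hv.exists_orthonormalBasis_extension_of_card_eq (by simp)
  have hcw : ∀ i, c i = √(hA.eigenvalues i) • w i := fun i => by
    by_cases hi : hA.eigenvalues i = 0
    · have : c i = 0 := by
        rw [← inner_self_eq_zero (𝕜 := ℝ), hc, diagonal_apply_eq, hi]
      simp [this, hi]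
    · have hi' : √(hA.eigenvalues i) ≠ 0 := by
        rw [Real.sqrt_ne_zero (hnonneg i)]; exact hi
      rw [hw i hi]
      simp only [v]
      rw [smul_smul, mul_inv_cancel₀ hi', one_smul]
  let W : Matrix n n ℝ := of fun k i => w i k
  refine ⟨U, W, hU, ?_, ?_⟩
  · rw [mul_eq_one_comm]
    ext i j
    have := orthonormal_iff_ite.mp w.orthonormal i j
    rw [PiLp.inner_apply] at this
    simpa [W, Matrix.mul_apply, one_apply, mul_comm] using this
  · have hAW : Aᵀ * U = W * diagonal (fun i => √(hA.eigenvalues i)) := by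
      ext k i
      have := congrArg (fun x : EuclideanSpace ℝ n => x k) (hcw i)
      rw [mul_diagonal]
      simpa [c, W, mul_comm] using this
    calc A = U * (Aᵀ * U)ᵀ := by
          rw [transpose_mul, transpose_transpose, ← Matrix.mul_assoc, hU, Matrix.one_mul]
      _ = _ := by rw [hAW, transpose_mul, diagonal_transpose, Matrix.mul_assoc]

/-- A coupling form of the von Neumann trace inequality. -/
lemma exists_doublyStochastic_trace_le {n : Type*} [Fintype n] [DecidableEq n]
    {U W U' W' : Matrix n n ℝ} (hU : U * Uᵀ = 1) (hW : W * Wᵀ = 1) (hU' : U' * U'ᵀ = 1)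
    (hW' : W' * W'ᵀ = 1) {a b : n → ℝ} (ha : ∀ i, 0 ≤ a i) (hb : ∀ i, 0 ≤ b i) :
    ∃ M ∈ doublyStochastic ℝ n,
      ((U * diagonal a * Wᵀ) * (U' * diagonal b * W'ᵀ)ᵀ).trace ≤
        ∑ i, ∑ j, M i j * (a i * b j) := by
  have hmul : ∀ {X Y : Matrix n n ℝ}, X * Xᵀ = 1 → Y * Yᵀ = 1 →
      (Xᵀ * Y) * (Xᵀ * Y)ᵀ = 1 := fun {X Y} hX hY => by
    calc (Xᵀ * Y) * (Xᵀ * Y)ᵀ = Xᵀ * (Y * Yᵀ) * X := by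
          simp [transpose_mul, Matrix.mul_assoc]
      _ = 1 := by rw [hY, Matrix.mul_one, mul_eq_one_comm.mp hX]
  refine ⟨avgSq (Wᵀ * W') (Uᵀ * U'), avgSq_mem_doublyStochastic (hmul hW hW') (hmul hU hU'), ?_⟩
  have htr : ((U * diagonal a * Wᵀ) * (U' * diagonal b * W'ᵀ)ᵀ).trace =
      ∑ i, ∑ j, (Wᵀ * W') i j * (Uᵀ * U') i j * (a i * b j) := by
    calc _ = (U * (diagonal a * (Wᵀ * W') * diagonal b * U'ᵀ)).trace := by
          simp [transpose_mul, Matrix.mul_assoc]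
      _ = ((diagonal a * (Wᵀ * W') * diagonal b) * (Uᵀ * U')ᵀ).trace := by
          rw [trace_mul_comm]; simp [transpose_mul, Matrix.mul_assoc]
      _ = _ := by
          rw [trace]
          refine Finset.sum_congr rfl fun i _ => ?_
          rw [diag_apply, Matrix.mul_apply]
          refine Finset.sum_congr rfl fun j _ => ?_
          rw [mul_diagonal, diagonal_mul, transpose_apply]
          ring
  rw [htr]
  refine Finset.sum_le_sum fun i _ => Finset.sum_le_sum fun j _ => ?_
  refine mul_le_mul_of_nonneg_right ?_ (mul_nonneg (ha i) (hb j))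
  simp only [avgSq, of_apply]
  linarith [two_mul_le_add_sq ((Wᵀ * W') i j) ((Uᵀ * U') i j)]

section DoublyStochastic

variable {n : Type*} [Fintype n] [DecidableEq n] {M : Matrix n n ℝ}

lemma sum_doublyStochastic_mul_left (hM : M ∈ doublyStochastic ℝ n) (f : n → ℝ) :
    ∑ i, ∑ j, M i j * f i = ∑ i, f i := by
  simp_rw [← Finset.sum_mul, sum_row_of_mem_doublyStochastic hM, one_mul]

lemma sum_doublyStochastic_mul_right (hM : M ∈ doublyStochastic ℝ n) (f : n → ℝ) :
    ∑ i, ∑ j, M i j * f j = ∑ j, f j := by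
  rw [Finset.sum_comm]
  simp_rw [← Finset.sum_mul, sum_col_of_mem_doublyStochastic hM, one_mul]

lemma card_filter_le_add_of_doublyStochastic (hM : M ∈ doublyStochastic ℝ n) (f g : n → ℝ)
    {x y ε : ℝ} (hε : 0 < ε) (hxy : x + ε ≤ y) :
    ((Finset.univ.filter fun i => f i ≤ x).card : ℝ) ≤
      (Finset.univ.filter fun j => g j ≤ y).card + (∑ i, ∑ j, M i j * |f i - g j|) / ε := by
  simp only [Finset.card_filter, Nat.cast_sum, Nat.cast_ite, Nat.cast_one, Nat.cast_zero]
  rw [← sum_doublyStochastic_mul_left hM fun i => if f i ≤ x then (1 : ℝ) else 0,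
    ← sum_doublyStochastic_mul_right hM fun j => if g j ≤ y then (1 : ℝ) else 0,
    Finset.sum_div, ← Finset.sum_add_distrib]
  refine Finset.sum_le_sum fun i _ => ?_
  rw [Finset.sum_div, ← Finset.sum_add_distrib]
  refine Finset.sum_le_sum fun j _ => ?_
  rw [mul_div_assoc, ← mul_add]
  refine mul_le_mul_of_nonneg_left ?_ (nonneg_of_mem_doublyStochastic hM)
  have h0 : 0 ≤ |f i - g j| / ε := by positivity
  split_ifs with h1 h2
  · linarith
  · have : 1 ≤ |f i - g j| / ε := by
      rw [le_div_iff₀ hε, abs_sub_comm]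
      exact le_trans (by linarith) (le_abs_self _)
    linarith
  · linarith
  · linarith

end DoublyStochastic

lemma levyDist_nonneg (F G : ℝ → ℝ) : 0 ≤ levyDist F G :=
  Real.sInf_nonneg fun _ h => h.1.le

lemma levyDist_esd_sq_le {p : ℕ} (hp : 0 < p) {X Y : Matrix (Fin p) (Fin p) ℝ}
    (hX : X.IsHermitian) (hY : Y.IsHermitian) {M : Matrix (Fin p) (Fin p) ℝ}
    (hM : M ∈ doublyStochastic ℝ (Fin p)) :
    levyDist (esd X hX) (esd Y hY) ^ 2 ≤
      (∑ i, ∑ j, M i j * |hX.eigenvalues i - hY.eigenvalues j|) / p := by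
  have hp' : (0 : ℝ) < p := Nat.cast_pos.mpr hp
  set c := ∑ i, ∑ j, M i j * |hX.eigenvalues i - hY.eigenvalues j| with hc
  have hc' : ∑ i, ∑ j, Mᵀ i j * |hY.eigenvalues i - hX.eigenvalues j| = c := by
    rw [hc, Finset.sum_comm]
    simp_rw [transpose_apply, abs_sub_comm]
  have hMt : Mᵀ ∈ doublyStochastic ℝ (Fin p) := by
    rw [mem_doublyStochastic_iff_sum] at hM ⊢
    exact ⟨fun i j => hM.1 j i, hM.2.2, hM.2.1⟩
  have hc0 : 0 ≤ c := Finset.sum_nonneg fun i _ => Finset.sum_nonneg fun j _ =>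
    mul_nonneg (nonneg_of_mem_doublyStochastic hM) (abs_nonneg _)
  refine (Real.le_sqrt (levyDist_nonneg _ _) (by positivity)).mp ?_
  refine le_of_forall_gt_imp_ge_of_dense fun ε hε => ?_
  have hε0 : 0 < ε := (Real.sqrt_nonneg _).trans_lt hε
  have hεc : c / ε / p ≤ ε := by
    have := ((Real.sqrt_lt' hε0).mp hε).le
    rw [div_le_iff₀ hp'] at this
    rw [div_le_iff₀ hp', div_le_iff₀ hε0]
    linarith
  refine csInf_le ⟨0, fun _ h => h.1.le⟩ ⟨hε0, fun x => ⟨?_, ?_⟩⟩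
  · have := div_le_div_of_nonneg_right (card_filter_le_add_of_doublyStochastic hM
      hX.eigenvalues hY.eigenvalues (x := x - ε) (y := x) hε0 (by linarith)) hp'.le
    rw [add_div, ← hc] at this
    simp only [esd]
    linarith
  · have := div_le_div_of_nonneg_right (card_filter_le_add_of_doublyStochastic hMt
      hY.eigenvalues hX.eigenvalues (x := x) (y := x + ε) hε0 le_rfl) hp'.le
    rw [add_div, hc'] at this
    simp only [esd]
    linarith

/-- Cauchy–Schwarz for `|a i ^ 2 - b j ^ 2|` under a doubly stochastic coupling. -/
lemma sq_sum_doublyStochastic_abs_sq_sub_sq_le {n : Type*} [Fintype n] [DecidableEq n]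
    {M : Matrix n n ℝ} (hM : M ∈ doublyStochastic ℝ n) (a b : n → ℝ) :
    (∑ i, ∑ j, M i j * |a i ^ 2 - b j ^ 2|) ^ 2 ≤
      (∑ i, a i ^ 2 + ∑ j, b j ^ 2 - 2 * ∑ i, ∑ j, M i j * (a i * b j)) *
        (2 * (∑ i, a i ^ 2 + ∑ j, b j ^ 2)) := by
  have hnn : ∀ i j, 0 ≤ M i j := fun i j => nonneg_of_mem_doublyStochastic hM
  have hcs : (∑ i, ∑ j, M i j * |a i ^ 2 - b j ^ 2|) ^ 2 ≤
      (∑ i, ∑ j, M i j * (a i - b j) ^ 2) * (∑ i, ∑ j, M i j * (a i + b j) ^ 2) := by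
    simp only [← Fintype.sum_prod_type' (γ := ℝ)]
    refine Finset.sum_sq_le_sum_mul_sum_of_sq_le_mul _ (fun x _ => ?_) (fun x _ => ?_)
      (fun x _ => ?_)
    · exact mul_nonneg (hnn _ _) (sq_nonneg _)
    · exact mul_nonneg (hnn _ _) (sq_nonneg _)
    · rw [mul_pow, sq_abs]; exact le_of_eq (by ring)
  have hA := sum_doublyStochastic_mul_left hM (fun i => a i ^ 2)
  have hB := sum_doublyStochastic_mul_right hM (fun j => b j ^ 2)
  have hsub : ∑ i, ∑ j, M i j * (a i - b j) ^ 2 =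
      ∑ i, a i ^ 2 + ∑ j, b j ^ 2 - 2 * ∑ i, ∑ j, M i j * (a i * b j) := by
    rw [← hA, ← hB]
    simp only [Finset.mul_sum, ← Finset.sum_add_distrib, ← Finset.sum_sub_distrib]
    exact Finset.sum_congr rfl fun i _ => Finset.sum_congr rfl fun j _ => by ring
  have hadd : ∑ i, ∑ j, M i j * (a i + b j) ^ 2 ≤ 2 * (∑ i, a i ^ 2 + ∑ j, b j ^ 2) := by
    rw [← hA, ← hB]
    simp only [Finset.mul_sum, ← Finset.sum_add_distrib]
    refine Finset.sum_le_sum fun i _ => Finset.sum_le_sum fun j _ => ?_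
    nlinarith [mul_nonneg (hnn i j) (sq_nonneg (a i - b j))]
  rw [← hsub]
  refine hcs.trans (mul_le_mul_of_nonneg_left hadd ?_)
  exact Finset.sum_nonneg fun i _ => Finset.sum_nonneg fun j _ =>
    mul_nonneg (hnn i j) (sq_nonneg _)

/-- Difference inequality: the fourth power of the Levy distance between the ESDs of
`AAᵗ` and `BBᵗ` is bounded by `(2/p) tr((A−B)(A−B)ᵗ) · (1/p) tr(AAᵗ + BBᵗ)`. -/
theorem stmt4 {p : ℕ} (hp : 0 < p) (A B : Matrix (Fin p) (Fin p) ℝ)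
    (hA : (A * Aᵀ).IsHermitian) (hB : (B * Bᵀ).IsHermitian) :
    (levyDist (esd _ hA) (esd _ hB)) ^ 4 ≤
      (2 / p) * ((A - B) * (A - B)ᵀ).trace * ((1 / p) * (A * Aᵀ + B * Bᵀ).trace) := by
  have hp' : (0 : ℝ) < p := Nat.cast_pos.mpr hp
  obtain ⟨hA0, U, W, hU, hW, hAsvd⟩ := exists_svd A hA
  obtain ⟨hB0, U', W', hU', hW', hBsvd⟩ := exists_svd B hB
  obtain ⟨M, hM, htr⟩ := exists_doublyStochastic_trace_le hU hW hU' hW'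
    (fun i => Real.sqrt_nonneg (hA.eigenvalues i)) (fun i => Real.sqrt_nonneg (hB.eigenvalues i))
  rw [← hAsvd, ← hBsvd] at htr
  have htrA : (A * Aᵀ).trace = ∑ i, hA.eigenvalues i := by simpa using hA.trace_eq_sum_eigenvalues
  have htrB : (B * Bᵀ).trace = ∑ i, hB.eigenvalues i := by simpa using hB.trace_eq_sum_eigenvalues
  have htrsub : ((A - B) * (A - B)ᵀ).trace =
      (A * Aᵀ).trace + (B * Bᵀ).trace - 2 * (A * Bᵀ).trace := by
    have : (B * Aᵀ).trace = (A * Bᵀ).trace := by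
      rw [← trace_transpose, transpose_mul, transpose_transpose]
    simp only [transpose_sub, Matrix.sub_mul, Matrix.mul_sub, trace_sub, this]
    ring
  have hT : 0 ≤ (A * Aᵀ).trace + (B * Bᵀ).trace := by
    rw [htrA, htrB]
    exact add_nonneg (Finset.sum_nonneg fun i _ => hA0 i) (Finset.sum_nonneg fun i _ => hB0 i)
  have hcs := sq_sum_doublyStochastic_abs_sq_sub_sq_le hM
    (fun i => √(hA.eigenvalues i)) (fun i => √(hB.eigenvalues i))
  simp only [Real.sq_sqrt (hA0 _), Real.sq_sqrt (hB0 _), ← htrA, ← htrB] at hcs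
  have hlevy := levyDist_esd_sq_le hp hA hB hM
  set c := ∑ i, ∑ j, M i j * |hA.eigenvalues i - hB.eigenvalues j|
  calc levyDist (esd _ hA) (esd _ hB) ^ 4 = (levyDist (esd _ hA) (esd _ hB) ^ 2) ^ 2 := by ring
    _ ≤ (c / p) ^ 2 := pow_le_pow_left₀ (sq_nonneg _) hlevy 2
    _ = c ^ 2 / p ^ 2 := div_pow _ _ _
    _ ≤ (((A - B) * (A - B)ᵀ).trace * (2 * ((A * Aᵀ).trace + (B * Bᵀ).trace))) / p ^ 2 := by
      refine div_le_div_of_nonneg_right (hcs.trans ?_) (by positivity)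
      refine mul_le_mul_of_nonneg_right ?_ (by positivity)
      rw [htrsub]
      linarith
    _ = _ := by
      rw [trace_add]
      field_simp
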